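/- arXiv:1407.0054 — 2 statements merged into one kernel-verified Lean document; each statement's English description precedes it below -/
import Mathlib

section
/- For every ε > 0 there is a constant C(ε) such that for all positive integers q, l, u with gcd(l, q) = 1 and u ≤ q: |Σ_{b≤u} N₂(l·b; q) − (φ(q)/q)·u| ≤ C(ε)·q^{1/2+ε}. -/
/-- `N₂(n; q)` counts residues `x` mod `q` with `gcd(x, q) = 1` and `x² ≡ n (mod q)`. -/
def N2 (q : ℕ) (n : ℤ) : ℕ :=
  ((Finset.Icc 1 q).filter (fun x => Nat.gcd x q = 1 ∧ (q : ℤ) ∣ (x : ℤ) ^ 2 - n)).card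

theorem exists_card_divisors_le_rpow (ε : ℝ) (hε : 0 < ε) :
    ∃ C : ℝ, 0 < C ∧ ∀ n : ℕ, n ≠ 0 → (n.divisors.card : ℝ) ≤ C * (n : ℝ) ^ ε := by
  obtain ⟨B, hB⟩ := exists_nat_ge ((2 : ℝ) ^ (1 / ε))
  have hlog : 0 < Real.log 2 := Real.log_pos one_lt_two
  set A : ℝ := 1 + 1 / (ε * Real.log 2) with hA
  have hA1 : 1 ≤ A := by
    have : 0 < 1 / (ε * Real.log 2) := by positivity
    linarith
  have local_bound : ∀ p k : ℕ, 2 ≤ p →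
      ((k + 1 : ℕ) : ℝ) ≤ (if p < B then A else 1) * ((p : ℝ) ^ k) ^ ε := by
    intro p k hp
    have hp' : (2 : ℝ) ≤ p := by exact_mod_cast hp
    split_ifs with h
    · have h1 : ε * Real.log 2 * k + 1 ≤ ((2 : ℝ) ^ k) ^ ε := by
        rw [← Real.rpow_natCast, ← Real.rpow_mul zero_le_two, Real.rpow_def_of_pos two_pos]
        refine le_trans (le_of_eq ?_) (Real.add_one_le_exp _)
        ring
      have h2 : ((2 : ℝ) ^ k) ^ ε ≤ ((p : ℝ) ^ k) ^ ε := by gcongr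
      calc ((k + 1 : ℕ) : ℝ) ≤ A * (ε * Real.log 2 * k + 1) := by
            have : A * (ε * Real.log 2 * k + 1)
                = ε * Real.log 2 * k + 1 + k + 1 / (ε * Real.log 2) := by
              rw [hA]; field_simp; ring
            rw [this]
            push_cast
            have : 0 ≤ ε * Real.log 2 * k := by positivity
            have : 0 ≤ 1 / (ε * Real.log 2) := by positivity
            linarith
        _ ≤ _ := by gcongr; exact h1.trans h2
    · have h1 : (2 : ℝ) ≤ (p : ℝ) ^ ε := by
        calc (2 : ℝ) = ((2 : ℝ) ^ (1 / ε)) ^ ε := by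
              rw [← Real.rpow_mul zero_le_two, one_div_mul_cancel hε.ne', Real.rpow_one]
          _ ≤ (p : ℝ) ^ ε := by
              gcongr
              exact hB.trans (by exact_mod_cast not_lt.mp h)
      calc ((k + 1 : ℕ) : ℝ) ≤ (2 : ℝ) ^ k := by exact_mod_cast Nat.lt_two_pow_self
        _ ≤ ((p : ℝ) ^ ε) ^ k := by gcongr
        _ = _ := by
          rw [one_mul, ← Real.rpow_natCast, ← Real.rpow_natCast, ← Real.rpow_mul (by positivity),
            ← Real.rpow_mul (by positivity), mul_comm]
  refine ⟨A ^ B, by positivity, fun n hn => ?_⟩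
  have hn_eq : (n : ℝ) ^ ε = ∏ p ∈ n.primeFactors, ((p : ℝ) ^ n.factorization p) ^ ε := by
    rw [Real.finsetProd_rpow _ _ (fun i _ => by positivity)]
    congr 1
    conv_lhs => rw [← Nat.prod_factorization_pow_eq_self hn]
    simp [Finsupp.prod]
  rw [Nat.card_divisors hn, hn_eq, Nat.cast_prod]
  calc ∏ p ∈ n.primeFactors, ((n.factorization p + 1 : ℕ) : ℝ)
      ≤ ∏ p ∈ n.primeFactors, ((if p < B then A else 1) * ((p : ℝ) ^ n.factorization p) ^ ε) :=
        Finset.prod_le_prod (fun _ _ => by positivity)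
          fun p hp => local_bound p _ (Nat.prime_of_mem_primeFactors hp).two_le
    _ = (∏ p ∈ n.primeFactors, if p < B then A else 1) *
          ∏ p ∈ n.primeFactors, ((p : ℝ) ^ n.factorization p) ^ ε := Finset.prod_mul_distrib
    _ ≤ _ := by
      gcongr
      rw [← Finset.prod_filter, Finset.prod_const]
      refine pow_le_pow_right₀ hA1 ?_
      calc _ ≤ (Finset.range B).card := Finset.card_le_card fun p hp => by simp_all
        _ = B := Finset.card_range B

theorem sum_Icc_cast_zmod (q : ℕ) [NeZero q] {M : Type*} [AddCommMonoid M] (f : ZMod q → M) :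
    ∑ x ∈ Finset.Icc 1 q, f x = ∑ y, f y := by
  refine Finset.sum_bij (fun x _ => (x : ZMod q)) (fun _ _ => Finset.mem_univ _) ?_ ?_
    (fun _ _ => rfl)
  · intro a ha b hb h
    rw [Finset.mem_Icc] at ha hb
    rw [ZMod.natCast_eq_natCast_iff] at h
    refine (Nat.ModEq.eq_of_abs_lt h ?_)
    rw [abs_lt]; omega
  · intro y _
    by_cases hy : y = 0
    · exact ⟨q, by simp [NeZero.one_le], by simp [hy]⟩
    · refine ⟨y.val, ?_, by simp⟩
      have := ZMod.val_lt y
      have : y.val ≠ 0 := by simpa using hy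
      simp; omega

theorem sum_Icc_mul_of_periodic {M : Type*} [AddCommMonoid M] (g : ℕ → M) (m d : ℕ)
    (hg : Function.Periodic g m) :
    ∑ k ∈ Finset.Icc 1 (d * m), g k = d • ∑ k ∈ Finset.Icc 1 m, g k := by
  have shift (n : ℕ) : ∑ k ∈ Finset.Icc 1 n, g k = ∑ k ∈ Finset.range n, g (k + 1) := by
    induction n with
    | zero => simp
    | succ n ih => rw [Finset.sum_Icc_succ_top (by omega), ih, Finset.sum_range_succ]
  simp only [shift]
  induction d with
  | zero => simp
  | succ d ih =>
    rw [add_mul, one_mul, Finset.sum_range_add, ih, succ_nsmul]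
    congr 1
    refine Finset.sum_congr rfl fun k _ => ?_
    rw [add_assoc, add_comm]
    simpa using hg.nat_mul d (k+1)

theorem sum_moebius_divisors_ite (q x : ℕ) (hq : q ≠ 0) :
    (∑ d ∈ q.divisors, if d ∣ x then ArithmeticFunction.moebius d else 0) =
      if Nat.gcd x q = 1 then 1 else 0 := by
  have h : q.divisors.filter (· ∣ x) = (Nat.gcd x q).divisors := by
    ext d
    simp [Nat.dvd_gcd_iff, hq, and_comm]
  rw [← Finset.sum_filter, h, ← ArithmeticFunction.coe_mul_zeta_apply,
    ArithmeticFunction.moebius_mul_coe_zeta, ArithmeticFunction.one_apply]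

theorem norm_sq_quadratic_gaussSum_le (q : ℕ) [NeZero q] (c : ZMod q) :
    ‖∑ y, ZMod.stdAddChar (c * y ^ 2)‖ ^ 2
      ≤ q * (Finset.univ.filter fun h : ZMod q => 2 * c * h = 0).card := by
  have key : ((‖∑ y, ZMod.stdAddChar (c * y ^ 2)‖ ^ 2 : ℝ) : ℂ)
      = ∑ h : ZMod q, ZMod.stdAddChar (c * h ^ 2) * (if 2 * c * h = 0 then (q : ℂ) else 0) := by
    push_cast
    rw [← Complex.mul_conj', map_sum, Finset.sum_mul_sum, Finset.sum_comm]
    calc _ = ∑ y : ZMod q, ∑ h : ZMod q,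
          ZMod.stdAddChar (c * h ^ 2) * ZMod.stdAddChar (y * (2 * c * h)) := by
          refine Finset.sum_congr rfl fun y _ => ?_
          rw [← Equiv.sum_comp (Equiv.addRight y)]
          refine Finset.sum_congr rfl fun h _ => ?_
          rw [← AddChar.map_neg_eq_conj, ← AddChar.map_add_eq_mul, ← AddChar.map_add_eq_mul,
            Equiv.coe_addRight]
          congr 1
          ring
      _ = _ := by
          rw [Finset.sum_comm]
          refine Finset.sum_congr rfl fun h _ => ?_
          rw [← Finset.mul_sum, AddChar.sum_mulShift _ (ZMod.isPrimitive_stdAddChar q), ZMod.card]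
          push_cast
          rfl
  calc ‖∑ y, ZMod.stdAddChar (c * y ^ 2)‖ ^ 2
      = ‖((‖∑ y, ZMod.stdAddChar (c * y ^ 2)‖ ^ 2 : ℝ) : ℂ)‖ := by
        rw [Complex.norm_real, Real.norm_of_nonneg (by positivity)]
    _ ≤ ∑ h : ZMod q, if 2 * c * h = 0 then (q : ℝ) else 0 := by
        rw [key]
        refine (norm_sum_le _ _).trans (Finset.sum_le_sum fun h _ => ?_)
        rw [norm_mul, AddChar.norm_apply, one_mul]
        split_ifs <;> simp
    _ = _ := by
        rw [← Finset.sum_filter, Finset.sum_const, nsmul_eq_mul, mul_comm]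

theorem card_nsmul_eq_zero_le_gcd (q : ℕ) [NeZero q] (n : ℕ) :
    (Finset.univ.filter fun h : ZMod q => n • h = 0).card ≤ Nat.gcd n q := by
  refine le_trans (Finset.card_le_card fun h => ?_)
    (IsAddCyclic.card_nsmul_eq_zero_le (α := ZMod q) (Nat.gcd_pos_of_pos_right n (NeZero.pos q)))
  simp only [Finset.mem_filter, Finset.mem_univ, true_and]
  intro hn
  rw [← addOrderOf_dvd_iff_nsmul_eq_zero] at hn ⊢
  exact Nat.dvd_gcd hn (addOrderOf_dvd_iff_nsmul_eq_zero.2 (by simp))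

theorem norm_quadratic_gaussSum_dilate_le (q : ℕ) [NeZero q] (a : ℕ) {d : ℕ}
    (hd : 0 < d) {w : ZMod q} (hw : IsUnit w) :
    ‖∑ y : ZMod q, ZMod.stdAddChar ((a : ZMod q) * w * ((d : ZMod q) * y) ^ 2)‖
      ≤ d * √(2 * q * Nat.gcd a q) := by
  rw [← Real.sqrt_sq (Nat.cast_nonneg d), ← Real.sqrt_mul (by positivity)]
  refine Real.le_sqrt_of_sq_le ?_
  have h1 := norm_sq_quadratic_gaussSum_le q ((a : ZMod q) * w * (d : ZMod q) ^ 2)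
  have h2 : (Finset.univ.filter fun h : ZMod q =>
      2 * ((a : ZMod q) * w * (d : ZMod q) ^ 2) * h = 0).card ≤ 2 * d ^ 2 * Nat.gcd a q := by
    calc _ = (Finset.univ.filter fun h : ZMod q => (2 * d ^ 2 * a) • h = 0).card := by
          congr 1
          ext h
          simp only [Finset.mem_filter, Finset.mem_univ, true_and]
          rw [← hw.mul_right_eq_zero (b := (2 * d ^ 2 * a) • h)]
          rw [show 2 * ((a : ZMod q) * w * (d : ZMod q) ^ 2) * h = w * ((2 * d ^ 2 * a) • h) by
            rw [nsmul_eq_mul]; push_cast; ring]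
      _ ≤ Nat.gcd (2 * d ^ 2 * a) q := card_nsmul_eq_zero_le_gcd q _
      _ ≤ 2 * d ^ 2 * Nat.gcd a q := by
          refine Nat.le_of_dvd ?_ ?_
          · have := Nat.gcd_pos_of_pos_right a (NeZero.pos q)
            positivity
          · rw [← Nat.gcd_mul_left]
            exact Nat.gcd_dvd_gcd_mul_left_right _ _ _
  have h3 : ((Finset.univ.filter fun h : ZMod q =>
      2 * ((a : ZMod q) * w * (d : ZMod q) ^ 2) * h = 0).card : ℝ) ≤ 2 * d ^ 2 * Nat.gcd a q := by
    exact_mod_cast h2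
  simp only [mul_pow, ← mul_assoc] at h1 h3 ⊢
  refine h1.trans ((mul_le_mul_of_nonneg_left h3 (Nat.cast_nonneg q)).trans (le_of_eq ?_))
  ring

theorem norm_coprime_quadratic_gaussSum_le (q : ℕ) [NeZero q] (a : ℕ) {w : ZMod q}
    (hw : IsUnit w) :
    ‖∑ x ∈ (Finset.Icc 1 q).filter (fun x => Nat.gcd x q = 1),
        ZMod.stdAddChar ((a : ZMod q) * w * (x : ZMod q) ^ 2)‖
      ≤ q.divisors.card * √(2 * q * Nat.gcd a q) := by
  set F : ℕ → ℂ := fun x => ZMod.stdAddChar ((a : ZMod q) * w * (x : ZMod q) ^ 2) with hF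
  have hsieve : ∑ x ∈ (Finset.Icc 1 q).filter (fun x => Nat.gcd x q = 1), F x
      = ∑ d ∈ q.divisors, (ArithmeticFunction.moebius d : ℂ) *
          ∑ x ∈ (Finset.Icc 1 q).filter (d ∣ ·), F x := by
    simp only [Finset.mul_sum, Finset.sum_filter]
    rw [Finset.sum_comm]
    refine Finset.sum_congr rfl fun x _ => ?_
    have := congrArg (fun z : ℤ => (z : ℂ) * F x) (sum_moebius_divisors_ite q x (NeZero.ne q))
    simp only [Int.cast_sum, Finset.sum_mul] at this
    calc _ = (((if Nat.gcd x q = 1 then 1 else 0 : ℤ)) : ℂ) * F x := by split_ifs <;> simp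
      _ = _ := by
        rw [← this]
        refine Finset.sum_congr rfl fun d _ => ?_
        split_ifs <;> simp
  rw [hsieve, ← nsmul_eq_mul]
  refine (norm_sum_le _ _).trans (Finset.sum_le_card_nsmul _ _ _ fun d hd => ?_)
  obtain ⟨m, hm⟩ := Nat.dvd_of_mem_divisors hd
  have hq := NeZero.ne q
  have hd0 : 0 < d := Nat.pos_of_mem_divisors hd
  have hdil : ∑ x ∈ (Finset.Icc 1 q).filter (d ∣ ·), F x = ∑ k ∈ Finset.Icc 1 m, F (d * k) := by
    symm
    refine Finset.sum_bij (fun k _ => d * k) ?_ ?_ ?_ (fun _ _ => rfl)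
    · intro k hk
      rw [Finset.mem_Icc] at hk
      simp only [Finset.mem_filter, Finset.mem_Icc, dvd_mul_right, and_true]
      exact ⟨Nat.mul_pos hd0 hk.1, hm ▸ Nat.mul_le_mul_left d hk.2⟩
    · intro k _ k' _ h
      exact Nat.eq_of_mul_eq_mul_left hd0 h
    · intro x hx
      simp only [Finset.mem_filter, Finset.mem_Icc] at hx
      obtain ⟨⟨h1, h2⟩, k, rfl⟩ := hx
      refine ⟨k, Finset.mem_Icc.2 ⟨Nat.pos_of_mul_pos_left h1, ?_⟩, rfl⟩
      exact Nat.le_of_mul_le_mul_left (hm ▸ h2) hd0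
  have hper : Function.Periodic (fun k => F (d * k)) m := by
    intro k
    have : ((d * (k + m) : ℕ) : ZMod q) = ((d * k : ℕ) : ZMod q) := by
      rw [mul_add, ← hm]; simp
    simp only [hF, this]
  have hfull : (d : ℂ) * ∑ k ∈ Finset.Icc 1 m, F (d * k)
      = ∑ y : ZMod q, ZMod.stdAddChar ((a : ZMod q) * w * ((d : ZMod q) * y) ^ 2) := by
    rw [← nsmul_eq_mul, ← sum_Icc_mul_of_periodic _ _ _ hper, ← hm, ← sum_Icc_cast_zmod]
    simp [hF]
  have hb := norm_quadratic_gaussSum_dilate_le q a hd0 hw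
  rw [← hfull, norm_mul, Complex.norm_natCast] at hb
  rw [hdil, norm_mul]
  have hmu : ‖(ArithmeticFunction.moebius d : ℂ)‖ ≤ 1 := by
    rw [Complex.norm_intCast]; exact_mod_cast ArithmeticFunction.abs_moebius_le_one
  exact (mul_le_of_le_one_left (norm_nonneg _) hmu).trans
    (le_of_mul_le_mul_left hb (by exact_mod_cast hd0))

theorem norm_sum_stdAddChar_Icc_le (q : ℕ) [NeZero q] (u : ℕ) {a : ℕ} (ha : 0 < a) (haq : a < q) :
    ‖∑ b ∈ Finset.Icc 1 u, ZMod.stdAddChar (-((a : ZMod q) * (b : ZMod q)))‖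
      ≤ q / 2 * (1 / a + 1 / ((q - a : ℕ) : ℝ)) := by
  set z : ℂ := ZMod.stdAddChar (-(a : ZMod q)) with hz
  have hznorm : ‖z‖ = 1 := AddChar.norm_apply _ _
  have hgeom : (∑ b ∈ Finset.Icc 1 u, ZMod.stdAddChar (-((a : ZMod q) * (b : ZMod q)))) * (z - 1)
      = z * (z ^ u - 1) := by
    have hpow (b : ℕ) : ZMod.stdAddChar (-((a : ZMod q) * (b : ZMod q))) = z ^ b := by
      rw [hz, ← AddChar.map_nsmul_eq_pow, nsmul_eq_mul]
      congr 1
      ring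
    simp only [hpow]
    induction u with
    | zero => simp
    | succ u ih =>
      rw [Finset.sum_Icc_succ_top (by omega), add_mul, ih]
      ring
  have hq0 : (0 : ℝ) < q := by exact_mod_cast ha.trans haq
  have ha0 : (0 : ℝ) < a := by exact_mod_cast ha
  have hqa : ((q - a : ℕ) : ℝ) = q - a := Nat.cast_sub haq.le
  have hqa0 : (0 : ℝ) < q - a := by
    have : (a : ℝ) < q := by exact_mod_cast haq
    linarith
  have hsin : ‖z - 1‖ = 2 * |Real.sin (Real.pi * a / q)| := by
    have : z = Complex.exp (Complex.I * ((-(2 * Real.pi * a / q) : ℝ) : ℂ)) := by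
      have := ZMod.stdAddChar_coe (N := q) (-(a : ℤ))
      push_cast at this
      rw [hz, this]
      congr 1
      push_cast
      ring
    rw [this, Complex.norm_exp_I_mul_ofReal_sub_one, norm_mul, Real.norm_two, Real.norm_eq_abs,
      show -(2 * Real.pi * a / q) / 2 = -(Real.pi * a / q) by ring, Real.sin_neg, abs_neg]
  have hT : ‖∑ b ∈ Finset.Icc 1 u, ZMod.stdAddChar (-((a : ZMod q) * (b : ZMod q)))‖
      * |Real.sin (Real.pi * a / q)| ≤ 1 := by
    have h := congrArg norm hgeom
    rw [norm_mul, norm_mul, hsin, hznorm, one_mul] at h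
    have h2 : ‖z ^ u - 1‖ ≤ 2 := by
      refine (norm_sub_le _ _).trans ?_
      rw [norm_pow, hznorm]; norm_num
    linarith
  have hbound : ∀ t : ℝ, 0 < t → t ≤ q / 2 →
      Real.sin (Real.pi * t / q) = |Real.sin (Real.pi * a / q)| →
      ‖∑ b ∈ Finset.Icc 1 u, ZMod.stdAddChar (-((a : ZMod q) * (b : ZMod q)))‖ ≤ q / 2 * (1 / t) := by
    intro t ht htq hs
    have h1 : 2 / Real.pi * (Real.pi * t / q) ≤ Real.sin (Real.pi * t / q) := by
      refine Real.mul_le_sin (by positivity) ?_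
      rw [div_le_iff₀ hq0]
      nlinarith [Real.pi_pos]
    have h2 : 2 / Real.pi * (Real.pi * t / q) = 2 * t / q := by
      field_simp
    rw [h2, hs] at h1
    have h3 := (mul_le_mul_of_nonneg_left h1 (norm_nonneg _)).trans hT
    rw [show (q : ℝ) / 2 * (1 / t) = 1 / (2 * t / q) by field_simp]
    rwa [le_div_iff₀ (by positivity)]
  have hsin0 : 0 ≤ Real.sin (Real.pi * a / q) := by
    refine Real.sin_nonneg_of_nonneg_of_le_pi (by positivity) ?_
    rw [div_le_iff₀ hq0]
    nlinarith [Real.pi_pos]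
  rw [hqa]
  rcases le_total (a : ℝ) (q / 2) with h | h
  · refine (hbound a ha0 h (abs_of_nonneg hsin0).symm).trans ?_
    have : 0 < 1 / ((q : ℝ) - a) := by positivity
    gcongr
    linarith
  · refine (hbound (q - a) hqa0 (by linarith) ?_).trans ?_
    · rw [abs_of_nonneg hsin0, ← Real.sin_pi_sub]
      congr 1
      field_simp
      ring
    · have : 0 < 1 / (a : ℝ) := by positivity
      gcongr
      linarith

theorem sum_gcd_div_le (q : ℕ) (hq : q ≠ 0) :
    ∑ a ∈ Finset.Icc 1 (q - 1), (Nat.gcd a q : ℝ) / a ≤ q.divisors.card * (1 + Real.log q) := by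
  have hterm : ∀ a ∈ Finset.Icc 1 (q - 1), (Nat.gcd a q : ℝ) / a
      ≤ ∑ d ∈ q.divisors, if d ∣ a then (d : ℝ) / a else 0 := by
    intro a _
    have := Finset.single_le_sum (f := fun d : ℕ => if d ∣ a then (d : ℝ) / a else 0)
      (fun d _ => by positivity)
      (Nat.mem_divisors.2 ⟨Nat.gcd_dvd_right a q, hq⟩)
    simpa [Nat.gcd_dvd_left] using this
  refine (Finset.sum_le_sum hterm).trans ?_
  rw [Finset.sum_comm, ← nsmul_eq_mul]
  refine Finset.sum_le_card_nsmul _ _ _ fun d hd => ?_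
  have hd0 : 0 < d := Nat.pos_of_mem_divisors hd
  rw [← Finset.sum_filter]
  calc ∑ a ∈ (Finset.Icc 1 (q - 1)).filter (d ∣ ·), (d : ℝ) / a
      ≤ ∑ a ∈ (Finset.Icc 1 q).image (d * ·), (d : ℝ) / a := by
        refine Finset.sum_le_sum_of_subset_of_nonneg ?_ (fun _ _ _ => by positivity)
        intro a ha
        simp only [Finset.mem_filter, Finset.mem_Icc] at ha
        obtain ⟨⟨h1, h2⟩, k, rfl⟩ := ha
        refine Finset.mem_image_of_mem _ (Finset.mem_Icc.2 ⟨Nat.pos_of_mul_pos_left h1, ?_⟩)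
        have := Nat.le_mul_of_pos_left k hd0
        omega
    _ = ∑ k ∈ Finset.Icc 1 q, ((k : ℝ))⁻¹ := by
        rw [Finset.sum_image fun _ _ _ _ h => Nat.eq_of_mul_eq_mul_left hd0 h]
        refine Finset.sum_congr rfl fun k _ => ?_
        push_cast
        have : (d : ℝ) ≠ 0 := by positivity
        rw [div_mul_eq_div_div, div_self this, one_div]
    _ ≤ 1 + Real.log q := by
        have := harmonic_le_one_add_log q
        rw [harmonic_eq_sum_Icc] at this
        push_cast at this
        exact this

theorem mul_sum_N2_eq (q : ℕ) [NeZero q] (l u : ℕ) (hlq : Nat.gcd l q = 1) :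
    (q : ℂ) * ∑ b ∈ Finset.Icc 1 u, (N2 q ((l : ℤ) * b) : ℂ)
      = ∑ a : ZMod q, (∑ x ∈ (Finset.Icc 1 q).filter (fun x => Nat.gcd x q = 1),
            ZMod.stdAddChar (a * (l : ZMod q)⁻¹ * (x : ZMod q) ^ 2)) *
          ∑ b ∈ Finset.Icc 1 u, ZMod.stdAddChar (-(a * (b : ZMod q))) := by
  have hl : (l : ZMod q) * (l : ZMod q)⁻¹ = 1 := ZMod.coe_mul_inv_eq_one l hlq
  have hN (b : ℕ) : (q : ℂ) * (N2 q ((l : ℤ) * b) : ℂ)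
      = ∑ x ∈ (Finset.Icc 1 q).filter (fun x => Nat.gcd x q = 1),
          ∑ a : ZMod q, ZMod.stdAddChar (a * ((l : ZMod q)⁻¹ * (x : ZMod q) ^ 2 - (b : ZMod q))) := by
    rw [N2, Finset.card_filter, Finset.sum_filter, Nat.cast_sum, Finset.mul_sum]
    refine Finset.sum_congr rfl fun x _ => ?_
    by_cases hx : Nat.gcd x q = 1
    · have hiff : (q : ℤ) ∣ (x : ℤ) ^ 2 - (l : ℤ) * b ↔
          (l : ZMod q)⁻¹ * (x : ZMod q) ^ 2 - (b : ZMod q) = 0 := by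
        rw [← ZMod.intCast_zmod_eq_zero_iff_dvd]
        push_cast
        constructor <;> intro h
        · linear_combination (l : ZMod q)⁻¹ * h + b * hl
        · linear_combination (l : ZMod q) * h - x ^ 2 * hl
      rw [AddChar.sum_mulShift _ (ZMod.isPrimitive_stdAddChar q), ZMod.card]
      simp [hx, hiff]
    · simp [hx]
  simp only [Finset.mul_sum, hN, Finset.sum_mul]
  calc _ = ∑ b ∈ Finset.Icc 1 u, ∑ a : ZMod q,
        ∑ x ∈ (Finset.Icc 1 q).filter (fun x => Nat.gcd x q = 1),
          ZMod.stdAddChar (a * ((l : ZMod q)⁻¹ * (x : ZMod q) ^ 2 - (b : ZMod q))) :=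
        Finset.sum_congr rfl fun b _ => Finset.sum_comm
    _ = _ := by
      rw [Finset.sum_comm]
      refine Finset.sum_congr rfl fun a _ => Finset.sum_congr rfl fun b _ =>
        Finset.sum_congr rfl fun x _ => ?_
      rw [← AddChar.map_add_eq_mul]
      congr 1
      ring

theorem abs_sum_N2_sub_le (q l u : ℕ) (hq : 0 < q) (hlq : Nat.gcd l q = 1) :
    |(∑ b ∈ Finset.Icc 1 u, (N2 q ((l : ℤ) * b) : ℝ)) - (Nat.totient q : ℝ) / q * u|
      ≤ √2 * √q * (q.divisors.card : ℝ) ^ 2 * (1 + Real.log q) := by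
  have : NeZero q := ⟨hq.ne'⟩
  have hq0 : (0 : ℝ) < q := by exact_mod_cast hq
  set S : ℕ → ℂ := fun a => ∑ x ∈ (Finset.Icc 1 q).filter (fun x => Nat.gcd x q = 1),
    ZMod.stdAddChar ((a : ZMod q) * (l : ZMod q)⁻¹ * (x : ZMod q) ^ 2)
  set T : ℕ → ℂ := fun a => ∑ b ∈ Finset.Icc 1 u, ZMod.stdAddChar (-((a : ZMod q) * (b : ZMod q)))
  have hw : IsUnit (l : ZMod q)⁻¹ :=
    IsUnit.of_mul_eq_one (l : ZMod q) (by rw [mul_comm]; exact ZMod.coe_mul_inv_eq_one l hlq)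
  have hsum : (q : ℂ) * ((∑ b ∈ Finset.Icc 1 u, (N2 q ((l : ℤ) * b) : ℂ))
      - (Nat.totient q : ℂ) / q * u) = ∑ a ∈ Finset.Icc 1 (q - 1), S a * T a := by
    have hsplit (f : ℕ → ℂ) :
        ∑ a ∈ Finset.Icc 1 q, f a = ∑ a ∈ Finset.Icc 1 (q - 1), f a + f q := by
      conv_lhs => rw [← Nat.sub_add_cancel hq]
      rw [Finset.sum_Icc_succ_top (by omega), Nat.sub_add_cancel hq]
    have hmain := mul_sum_N2_eq q l u hlq
    rw [← sum_Icc_cast_zmod, hsplit] at hmain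
    have hcard : ((Finset.Icc 1 q).filter (fun x => Nat.gcd x q = 1)).card = Nat.totient q := by
      rw [← Nat.filter_coprime_Ico_eq_totient q 1]
      congr 1
      ext x
      simp only [Finset.mem_filter, Finset.mem_Icc, Finset.mem_Ico, Nat.coprime_comm (m := q),
        Nat.Coprime]
      omega
    have hqC : (q : ℂ) ≠ 0 := NeZero.ne _
    simp only [CharP.cast_eq_zero, zero_mul, neg_zero, AddChar.map_zero_eq_one, Finset.sum_const,
      hcard, Nat.card_Icc, Nat.add_sub_cancel, nsmul_eq_mul, mul_one] at hmain
    rw [mul_sub, hmain]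
    field_simp
    ring
  have hST : ∀ a ∈ Finset.Icc 1 (q - 1), ‖S a * T a‖ ≤
      q * (√2 * √q * q.divisors.card) *
        ((1 / 2) * ((Nat.gcd a q : ℝ) / a + (Nat.gcd (q - a) q : ℝ) / ((q - a : ℕ) : ℝ))) := by
    intro a ha
    rw [Finset.mem_Icc] at ha
    have hg : Nat.gcd (q - a) q = Nat.gcd a q := Nat.gcd_self_sub_left (by omega)
    have h1 := norm_coprime_quadratic_gaussSum_le q a hw
    have h2 := norm_sum_stdAddChar_Icc_le q u (a := a) (by omega) (by omega)
    have h3 : √(2 * q * Nat.gcd a q) ≤ √2 * √q * Nat.gcd a q := by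
      rw [Real.sqrt_mul (by positivity), Real.sqrt_mul (by positivity)]
      gcongr
      refine Real.sqrt_le_iff.2 ⟨by positivity, ?_⟩
      have : 1 ≤ Nat.gcd a q := Nat.gcd_pos_of_pos_right _ hq
      exact_mod_cast Nat.le_self_pow two_ne_zero _
    rw [norm_mul, hg]
    calc _ ≤ (q.divisors.card * (√2 * √q * Nat.gcd a q)) *
          ((q : ℝ) / 2 * (1 / a + 1 / ((q - a : ℕ) : ℝ))) := by
          refine mul_le_mul (h1.trans (by gcongr)) h2 (norm_nonneg _) (by positivity)
      _ = _ := by ring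
  have hreflect : ∑ a ∈ Finset.Icc 1 (q - 1), (Nat.gcd (q - a) q : ℝ) / ((q - a : ℕ) : ℝ)
      = ∑ a ∈ Finset.Icc 1 (q - 1), (Nat.gcd a q : ℝ) / a := by
    refine Finset.sum_bij (fun a _ => q - a) ?_ ?_ ?_ (fun _ _ => rfl)
    · intro a ha
      simp only [Finset.mem_Icc] at ha ⊢
      omega
    · intro a ha b hb h
      simp only [Finset.mem_Icc] at ha hb
      omega
    · intro a ha
      simp only [Finset.mem_Icc] at ha
      exact ⟨q - a, Finset.mem_Icc.2 (by omega), by omega⟩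
  have hbound : (q : ℝ) * |(∑ b ∈ Finset.Icc 1 u, (N2 q ((l : ℤ) * b) : ℝ))
      - (Nat.totient q : ℝ) / q * u|
      ≤ q * (√2 * √q * (q.divisors.card : ℝ) ^ 2 * (1 + Real.log q)) := by
    have hnorm := congrArg norm hsum
    have hcast : (q : ℂ) * ((∑ b ∈ Finset.Icc 1 u, (N2 q ((l : ℤ) * b) : ℂ))
        - (Nat.totient q : ℂ) / q * u) = (((q : ℝ) * ((∑ b ∈ Finset.Icc 1 u,
          (N2 q ((l : ℤ) * b) : ℝ)) - (Nat.totient q : ℝ) / q * u) : ℝ) : ℂ) := by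
      push_cast
      rfl
    rw [hcast, Complex.norm_real, norm_mul, Real.norm_of_nonneg hq0.le, Real.norm_eq_abs] at hnorm
    rw [hnorm]
    refine (norm_sum_le _ _).trans ((Finset.sum_le_sum hST).trans ?_)
    rw [← Finset.mul_sum, ← Finset.mul_sum, Finset.sum_add_distrib, hreflect]
    calc _ = q * (√2 * √q * q.divisors.card) *
          ∑ a ∈ Finset.Icc 1 (q - 1), (Nat.gcd a q : ℝ) / a := by ring
      _ ≤ q * (√2 * √q * q.divisors.card) * (q.divisors.card * (1 + Real.log q)) := by
          gcongr
          exact sum_gcd_div_le q hq.ne'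
      _ = _ := by ring
  exact le_of_mul_le_mul_left hbound hq0

theorem sum_N2_asymptotic : ∀ ε : ℝ, 0 < ε → ∃ C : ℝ, 0 < C ∧
    ∀ q l u : ℕ, 0 < q → 0 < l → 0 < u → Nat.gcd l q = 1 → u ≤ q →
      |(∑ b ∈ Finset.Icc 1 u, (N2 q ((l : ℤ) * b) : ℝ)) -
          (Nat.totient q : ℝ) / q * u| ≤ C * (q : ℝ) ^ ((1 : ℝ) / 2 + ε) := by
  intro ε hε
  obtain ⟨D, hD, hdiv⟩ := exists_card_divisors_le_rpow (ε / 4) (by positivity)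
  refine ⟨√2 * D ^ 2 * (1 + 1 / (ε / 2)), by positivity, fun q l u hq _ _ hlq _ => ?_⟩
  have hq1 : (1 : ℝ) ≤ q := by exact_mod_cast hq
  have hlog : 1 + Real.log q ≤ (1 + 1 / (ε / 2)) * (q : ℝ) ^ (ε / 2) := by
    have h1 := Real.log_le_rpow_div (Nat.cast_nonneg q) (half_pos hε)
    have h2 := Real.one_le_rpow hq1 (half_pos hε).le
    rw [add_mul, one_mul, one_div_mul_eq_div]
    linarith
  have hlog0 : 0 ≤ 1 + Real.log q := by
    have := Real.log_nonneg hq1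
    linarith
  calc _ ≤ √2 * √q * (q.divisors.card : ℝ) ^ 2 * (1 + Real.log q) :=
        abs_sum_N2_sub_le q l u hq hlq
    _ ≤ √2 * √q * (D * (q : ℝ) ^ (ε / 4)) ^ 2 * ((1 + 1 / (ε / 2)) * (q : ℝ) ^ (ε / 2)) := by
        gcongr
        exact hdiv q hq.ne'
    _ = √2 * D ^ 2 * (1 + 1 / (ε / 2)) *
          ((q : ℝ) ^ ((1 : ℝ) / 2) * ((q : ℝ) ^ (ε / 4) * (q : ℝ) ^ (ε / 4)) *
            (q : ℝ) ^ (ε / 2)) := by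
        rw [Real.sqrt_eq_rpow q]
        ring
    _ = _ := by
        rw [← Real.rpow_add (by positivity), ← Real.rpow_add (by positivity),
          ← Real.rpow_add (by positivity)]
        ring_nf
end

section
/- For every ε > 0 there is a constant C(ε) such that for all positive integers q, l, u with gcd(l, q) = 1 and u ≤ q: |Σ_{a≤u} N₃(l·a; q) − (φ(q)/q)·u| ≤ C(ε)·q^{1/2+ε}. -/
/-- `N₂(n; q)` counts residues `x` mod `q` with `gcd(x, q) = 1` and `x³ ≡ n (mod q)`. -/
def N3 (q : ℕ) (n : ℤ) : ℕ :=
  ((Finset.Icc 1 q).filter (fun x => Nat.gcd x q = 1 ∧ (q : ℤ) ∣ (x : ℤ) ^ 3 - n)).card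

open Finset

/-- The Gauss sum of a primitive Dirichlet character modulo `d` has absolute value `√d`. -/
lemma norm_gaussSum_of_isPrimitive {d : ℕ} [NeZero d] {χ : DirichletCharacter ℂ d}
    (hχ : χ.IsPrimitive) : ‖gaussSum χ ZMod.stdAddChar‖ = √d := by
  have key : gaussSum χ ZMod.stdAddChar * star (gaussSum χ ZMod.stdAddChar) = d := by
    calc gaussSum χ ZMod.stdAddChar * star (gaussSum χ ZMod.stdAddChar)
        = ∑ h, gaussSum χ (ZMod.stdAddChar.mulShift h) * ZMod.stdAddChar (-h) := by
          rw [star_gaussSum_eq, gaussSum, gaussSum, mul_sum]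
          refine sum_congr rfl fun h _ => ?_
          rw [gaussSum_mulShift_of_isPrimitive _ hχ, AddChar.inv_apply, gaussSum]
          ring
      _ = ∑ a, χ a * ∑ h, ZMod.stdAddChar (h * (a - 1)) := by
          simp only [gaussSum, sum_mul, mul_sum]
          rw [sum_comm]
          refine sum_congr rfl fun a _ => sum_congr rfl fun h _ => ?_
          rw [AddChar.mulShift_apply, mul_assoc, ← AddChar.map_add_eq_mul]
          congr 2
          ring
      _ = d := by
          simp only [AddChar.sum_mulShift _ (ZMod.isPrimitive_stdAddChar d), sub_eq_zero]
          simp [ZMod.card]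
  have h2 : (‖gaussSum χ ZMod.stdAddChar‖ : ℝ) ^ 2 = d := by
    have := congrArg norm key
    rwa [norm_mul, norm_star, ← sq, Complex.norm_natCast] at this
  rw [← h2, Real.sqrt_sq (norm_nonneg _)]

lemma two_mul_mul_one_sub_le_sin_pi_mul {x : ℝ} (h0 : 0 ≤ x) (h1 : x ≤ 1) :
    2 * x * (1 - x) ≤ Real.sin (Real.pi * x) := by
  have hpi := Real.pi_pos
  have key : ∀ y : ℝ, 0 ≤ y → y ≤ 1 / 2 → 2 * y ≤ Real.sin (Real.pi * y) := by
    intro y hy hy'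
    have := Real.mul_le_sin (x := Real.pi * y) (by positivity) (by nlinarith)
    calc 2 * y = 2 / Real.pi * (Real.pi * y) := by field_simp
      _ ≤ _ := this
  rcases le_total x (1 / 2) with h | h
  · have := key x h0 h
    nlinarith
  · have := key (1 - x) (by linarith) (by linarith)
    rw [mul_sub Real.pi, mul_one, Real.sin_pi_sub] at this
    nlinarith

lemma norm_sum_stdAddChar_le {d : ℕ} [NeZero d] {h : ZMod d} (hh : h ≠ 0) (M : ℕ) :
    ‖∑ b ∈ Icc 1 M, ZMod.stdAddChar ((b : ZMod d) * h)‖ ≤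
      d / 2 * (1 / (h.val : ℝ) + 1 / ((d - h.val : ℕ) : ℝ)) := by
  have hd : (0 : ℝ) < d := by exact_mod_cast Nat.pos_of_neZero d
  have hlt := ZMod.val_lt h
  have hk : (0 : ℝ) < h.val := by
    exact_mod_cast Nat.pos_of_ne_zero (by rwa [Ne, ZMod.val_eq_zero])
  have hk' : (h.val : ℝ) < d := by exact_mod_cast hlt
  set z : ℂ := ZMod.stdAddChar h with hz
  have hnorm : ‖z‖ = 1 := by simp [hz]
  have hz1 : ‖z - 1‖ = 2 * Real.sin (Real.pi * (h.val / d)) := by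
    have : z = Complex.exp (Complex.I * ((2 * Real.pi * (h.val / d) : ℝ) : ℂ)) := by
      rw [hz, ← ZMod.natCast_zmod_val h, ← Int.cast_natCast (R := ZMod d), ZMod.stdAddChar_coe]
      congr 1
      push_cast [ZMod.natCast_zmod_val]
      ring
    rw [this, Complex.norm_exp_I_mul_ofReal_sub_one, Real.norm_of_nonneg]
    · congr 2; ring
    · have : Real.sin (2 * Real.pi * (h.val / d) / 2) = Real.sin (Real.pi * (h.val / d)) := by
        congr 1; ring
      rw [this]
      have := two_mul_mul_one_sub_le_sin_pi_mul (x := h.val / d) (by positivity)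
        ((div_le_one hd).2 hk'.le)
      have h3 : (0 : ℝ) ≤ 1 - h.val / d := sub_nonneg.2 ((div_le_one hd).2 hk'.le)
      have : 0 ≤ 2 * ((h.val : ℝ) / d) * (1 - h.val / d) := by positivity
      linarith
  have hlow : 4 * ((h.val : ℝ) / d) * (1 - h.val / d) ≤ ‖z - 1‖ := by
    have := two_mul_mul_one_sub_le_sin_pi_mul (x := h.val / d) (by positivity)
        ((div_le_one hd).2 hk'.le)
    linarith
  have hpos : 0 < 4 * ((h.val : ℝ) / d) * (1 - h.val / d) := by
    have h3 : (0 : ℝ) < 1 - h.val / d := sub_pos.2 ((div_lt_one hd).2 hk')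
    positivity
  have hne : z ≠ 1 := by
    intro h0
    rw [h0, sub_self, norm_zero] at hlow
    linarith
  have hsum : ∑ b ∈ Icc 1 M, ZMod.stdAddChar ((b : ZMod d) * h) = z * ((z ^ M - 1) / (z - 1)) := by
    rw [← geom_sum_eq hne, mul_sum, ← Ico_add_one_right_eq_Icc, sum_Ico_eq_sum_range]
    refine sum_congr (by simp) fun i _ => ?_
    rw [← nsmul_eq_mul, AddChar.map_nsmul_eq_pow, pow_add, pow_one]
  rw [hsum, norm_mul, hnorm, one_mul, norm_div]
  have hnum : ‖z ^ M - 1‖ ≤ 2 := by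
    refine (norm_sub_le _ _).trans ?_
    rw [norm_pow, hnorm, one_pow, norm_one]; norm_num
  calc ‖z ^ M - 1‖ / ‖z - 1‖ ≤ 2 / (4 * ((h.val : ℝ) / d) * (1 - h.val / d)) := by
        gcongr
    _ = d / 2 * (1 / (h.val : ℝ) + 1 / ((d - h.val : ℕ) : ℝ)) := by
        rw [Nat.cast_sub hlt.le]
        have : (d : ℝ) - h.val ≠ 0 := by linarith
        field_simp
        ring

lemma sum_zmod_ne_zero_eq_sum_Ico {d : ℕ} [NeZero d] (f : ℕ → ℝ) :
    ∑ h : ZMod d with h ≠ 0, f h.val = ∑ k ∈ Ico 1 d, f k := by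
  refine sum_bij (fun h _ => h.val) ?_ ?_ ?_ ?_
  · intro h hh
    have : h.val ≠ 0 := by simpa using hh
    exact mem_Ico.2 ⟨Nat.one_le_iff_ne_zero.2 this, ZMod.val_lt h⟩
  · intro a _ b _ hab
    exact ZMod.val_injective d hab
  · intro k hk
    rw [mem_Ico] at hk
    refine ⟨k, ?_, ZMod.val_cast_of_lt hk.2⟩
    have := ZMod.val_cast_of_lt hk.2
    simp only [mem_filter, mem_univ, true_and]
    intro h0
    rw [h0, ZMod.val_zero] at this
    omega
  · simp

lemma sum_Ico_one_div_le (d : ℕ) [NeZero d] :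
    ∑ k ∈ Ico 1 d, 1 / (k : ℝ) ≤ 1 + Real.log d := by
  have h := harmonic_le_one_add_log d
  rw [harmonic_eq_sum_Icc] at h
  push_cast at h
  refine le_trans ?_ h
  simp only [one_div]
  exact sum_le_sum_of_subset_of_nonneg
    (fun k hk => by simp only [mem_Ico, mem_Icc] at *; omega) fun _ _ _ => by positivity

/-- The Pólya–Vinogradov inequality for a primitive character. -/
lemma norm_sum_Icc_le_of_isPrimitive {d : ℕ} [NeZero d] {χ : DirichletCharacter ℂ d}
    (hχ : χ.IsPrimitive) (hd : d ≠ 1) (M : ℕ) :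
    ‖∑ b ∈ Icc 1 M, χ (b : ZMod d)‖ ≤ √d * (1 + Real.log d) := by
  have hd0 : (0 : ℝ) < d := by exact_mod_cast Nat.pos_of_neZero d
  have hprim : (χ⁻¹).IsPrimitive := by
    rw [DirichletCharacter.isPrimitive_def] at hχ ⊢
    rw [DirichletCharacter.conductor_inv, hχ]
  have key : gaussSum χ⁻¹ ZMod.stdAddChar * ∑ b ∈ Icc 1 M, χ (b : ZMod d) =
      ∑ h : ZMod d with h ≠ 0, χ⁻¹ h * ∑ b ∈ Icc 1 M, ZMod.stdAddChar ((b : ZMod d) * h) := by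
    have h0 : ∑ h : ZMod d with h ≠ 0, χ⁻¹ h *
        ∑ b ∈ Icc 1 M, ZMod.stdAddChar ((b : ZMod d) * h) =
        ∑ h : ZMod d, χ⁻¹ h * ∑ b ∈ Icc 1 M, ZMod.stdAddChar ((b : ZMod d) * h) := by
      refine sum_subset (subset_univ _) fun h _ hh => ?_
      have : h = 0 := by simpa using hh
      rw [this, DirichletCharacter.map_zero' _ hd, zero_mul]
    rw [h0]
    simp only [mul_sum]
    rw [sum_comm]
    refine sum_congr rfl fun b _ => ?_
    have := gaussSum_mulShift_of_isPrimitive ZMod.stdAddChar hprim (b : ZMod d)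
    rw [inv_inv] at this
    rw [mul_comm, ← this]
    simp [gaussSum, AddChar.mulShift_apply]
  have hbound : √d * ‖∑ b ∈ Icc 1 M, χ (b : ZMod d)‖ ≤ d * (1 + Real.log d) := by
    rw [← norm_gaussSum_of_isPrimitive hprim, ← norm_mul, key]
    calc _ ≤ ∑ h : ZMod d with h ≠ 0,
            (d / 2 * (1 / (h.val : ℝ) + 1 / ((d - h.val : ℕ) : ℝ))) := by
          refine norm_sum_le_of_le _ fun h hh => ?_
          rw [norm_mul]
          refine (mul_le_of_le_one_left (norm_nonneg _)
            (DirichletCharacter.norm_le_one _ _)).trans ?_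
          exact norm_sum_stdAddChar_le (by simpa using hh) M
      _ = d / 2 * (∑ k ∈ Ico 1 d, 1 / (k : ℝ) + ∑ k ∈ Ico 1 d, 1 / ((d - k : ℕ) : ℝ)) := by
          rw [sum_zmod_ne_zero_eq_sum_Ico
            (fun k => (d : ℝ) / 2 * (1 / (k : ℝ) + 1 / ((d - k : ℕ) : ℝ))), ← mul_sum,
            sum_add_distrib]
      _ = d * ∑ k ∈ Ico 1 d, 1 / (k : ℝ) := by
          have : ∑ k ∈ Ico 1 d, 1 / ((d - k : ℕ) : ℝ) = ∑ k ∈ Ico 1 d, 1 / (k : ℝ) := by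
            have := sum_Ico_reflect (fun k : ℕ => 1 / (k : ℝ)) 1 (n := d) (m := d) (by omega)
            simpa using this
          rw [this]; ring
      _ ≤ _ := by gcongr; exact sum_Ico_one_div_le d
  have hs : 0 < √(d : ℝ) := Real.sqrt_pos.2 hd0
  refine le_of_mul_le_mul_left (hbound.trans_eq ?_) hs
  rw [← mul_assoc, Real.mul_self_sqrt hd0.le]

/-- Sieving by `gcd(b, q) = 1` through Möbius inversion. -/
lemma sum_Icc_coprime_eq_sum_moebius {q : ℕ} (hq : 0 < q) (f : ℕ → ℂ) (u : ℕ) :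
    ∑ b ∈ Icc 1 u, (if b.Coprime q then f b else 0) =
      ∑ e ∈ q.divisors, (ArithmeticFunction.moebius e : ℂ) * ∑ b ∈ Icc 1 (u / e), f (e * b) := by
  have hmu : ∀ b ∈ Icc 1 u, (if b.Coprime q then f b else 0) =
      ∑ e ∈ q.divisors, if e ∣ b then (ArithmeticFunction.moebius e : ℂ) * f b else 0 := by
    intro b hb
    rw [← sum_filter, ← sum_mul]
    have hdiv : q.divisors.filter (· ∣ b) = (b.gcd q).divisors := by
      ext e
      simp only [mem_filter, Nat.mem_divisors, Nat.dvd_gcd_iff, ne_eq, Nat.gcd_eq_zero_iff]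
      constructor
      · rintro ⟨⟨h1, h2⟩, h3⟩; exact ⟨⟨h3, h1⟩, fun h => h2 h.2⟩
      · rintro ⟨⟨h1, h2⟩, _⟩; exact ⟨⟨h2, hq.ne'⟩, h1⟩
    rw [hdiv]
    have := congrArg (fun F => F (b.gcd q))
      (ArithmeticFunction.coe_moebius_mul_coe_zeta (R := ℂ))
    simp only [ArithmeticFunction.coe_mul_zeta_apply, ArithmeticFunction.one_apply,
      ArithmeticFunction.intCoe_apply] at this
    rw [this]
    simp [Nat.Coprime]
  rw [sum_congr rfl hmu, sum_comm]
  refine sum_congr rfl fun e he => ?_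
  have he0 : 0 < e := Nat.pos_of_mem_divisors he
  rw [← sum_filter, ← mul_sum]
  congr 1
  symm
  refine sum_bij (fun b _ => e * b) ?_ ?_ ?_ ?_
  · intro b hb
    rw [mem_Icc] at hb
    simp only [mem_filter, mem_Icc, dvd_mul_right, and_true]
    exact ⟨Nat.mul_pos he0 hb.1, by
      rw [mul_comm]; exact (Nat.le_div_iff_mul_le he0).1 hb.2⟩
  · intro a _ b _ h
    exact Nat.eq_of_mul_eq_mul_left he0 h
  · intro b hb
    simp only [mem_filter, mem_Icc] at hb
    obtain ⟨⟨h1, h2⟩, c, rfl⟩ := hb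
    refine ⟨c, mem_Icc.2 ⟨Nat.pos_of_mul_pos_left h1, ?_⟩, rfl⟩
    rw [Nat.le_div_iff_mul_le he0, mul_comm]; exact h2
  · simp

lemma norm_moebius_le_one (e : ℕ) : ‖(ArithmeticFunction.moebius e : ℂ)‖ ≤ 1 := by
  rw [Complex.norm_intCast]
  exact_mod_cast ArithmeticFunction.abs_moebius_le_one

/-- The number of integers up to `u` coprime to `q` is `φ(q)/q * u` up to `d(q)`. -/
lemma norm_sum_Icc_coprime_sub_le {q : ℕ} (hq : 0 < q) (u : ℕ) :
    ‖∑ b ∈ Icc 1 u, (if b.Coprime q then (1 : ℂ) else 0) - (Nat.totient q : ℂ) / q * u‖ ≤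
      #q.divisors := by
  have hqc : (q : ℂ) ≠ 0 := by exact_mod_cast hq.ne'
  have htot : (Nat.totient q : ℂ) =
      ∑ e ∈ q.divisors, (ArithmeticFunction.moebius e : ℂ) * ((q : ℂ) / e) := by
    have h1 := sum_Icc_coprime_eq_sum_moebius hq (fun _ => 1) q
    have h2 : (Nat.totient q : ℂ) = ∑ b ∈ Icc 1 q, (if b.Coprime q then (1 : ℂ) else 0) := by
      rw [sum_boole, ← Nat.filter_coprime_Ico_eq_totient q 1, ← Ico_add_one_right_eq_Icc,
        add_comm q]
      simp only [Nat.coprime_comm]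
    rw [h2, h1]
    refine sum_congr rfl fun e he => ?_
    simp [Nat.cast_div_charZero (Nat.dvd_of_mem_divisors he)]
  rw [sum_Icc_coprime_eq_sum_moebius hq (fun _ => 1), htot, sum_div, sum_mul, ← sum_sub_distrib,
    card_eq_sum_ones, Nat.cast_sum]
  refine norm_sum_le_of_le _ fun e he => ?_
  have he0 : 0 < e := Nat.pos_of_mem_divisors he
  have hec : (e : ℝ) ≠ 0 := by exact_mod_cast he0.ne'
  have : (ArithmeticFunction.moebius e : ℂ) * ∑ b ∈ Icc 1 (u / e), (1 : ℂ) -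
      (ArithmeticFunction.moebius e : ℂ) * ((q : ℂ) / e) / q * u =
      (ArithmeticFunction.moebius e : ℂ) * (((u / e : ℕ) : ℝ) - (u : ℝ) / e : ℝ) := by
    simp only [sum_const, Nat.card_Icc, add_tsub_cancel_right, nsmul_eq_mul, mul_one]
    push_cast
    field_simp
  rw [this, norm_mul, Complex.norm_real, Nat.cast_one]
  refine mul_le_one₀ (norm_moebius_le_one e) (norm_nonneg _) ?_
  rw [Real.norm_eq_abs, abs_sub_comm, ← Nat.floor_div_eq_div (K := ℝ), abs_le]
  have h1 := Nat.floor_le (a := (u : ℝ) / e) (by positivity)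
  have h2 := Nat.lt_floor_add_one ((u : ℝ) / e)
  constructor <;> linarith

lemma norm_sum_Icc_le_of_ne_one {q : ℕ} [NeZero q] {χ : DirichletCharacter ℂ q} (hχ : χ ≠ 1)
    (u : ℕ) : ‖∑ b ∈ Icc 1 u, χ (b : ZMod q)‖ ≤ #q.divisors * (√q * (1 + Real.log q)) := by
  have hq : 0 < q := Nat.pos_of_neZero q
  have : NeZero χ.conductor := ⟨χ.conductor_ne_zero⟩
  have hle : χ.conductor ≤ q := Nat.le_of_dvd hq χ.conductor_dvd_level
  have hd1 : χ.conductor ≠ 1 := fun h =>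
    hχ ((DirichletCharacter.eq_one_iff_conductor_eq_one).2 h)
  have hval : ∀ b ∈ Icc 1 u, χ (b : ZMod q) =
      if b.Coprime q then χ.primitiveCharacter (b : ZMod χ.conductor) else 0 := by
    intro b _
    split_ifs with h
    · have := χ.primitiveCharacter_apply_of_isCoprime (Nat.isCoprime_iff_coprime.2 h)
      simpa using this.symm
    · exact MulChar.map_nonunit _ (by rwa [ZMod.isUnit_iff_coprime])
  rw [sum_congr rfl hval, sum_Icc_coprime_eq_sum_moebius hq
    (fun b => χ.primitiveCharacter (b : ZMod χ.conductor)), ← nsmul_eq_mul]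
  refine (norm_sum_le_of_le _ fun e _ => ?_).trans_eq (sum_const _)
  simp only [Nat.cast_mul, map_mul, ← mul_sum, norm_mul]
  refine (mul_le_of_le_one_left (by positivity) (norm_moebius_le_one e)).trans ?_
  refine (mul_le_of_le_one_left (norm_nonneg _) (DirichletCharacter.norm_le_one _ _)).trans ?_
  refine (norm_sum_Icc_le_of_isPrimitive χ.primitiveCharacter_isPrimitive hd1 _).trans ?_
  have hpos : (0 : ℝ) < χ.conductor := by exact_mod_cast Nat.pos_of_neZero _
  have : 0 ≤ Real.log χ.conductor := Real.log_natCast_nonneg _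
  gcongr

lemma card_divisors_le_pow_mul_rpow {δ A : ℝ} {P : ℕ} (hδ : 0 < δ) (hA : 1 ≤ A)
    (hA2 : ∀ k : ℕ, (k : ℝ) + 1 ≤ A * ((2 : ℝ) ^ δ) ^ k) (hP : 2 ≤ (P : ℝ) ^ δ) (n : ℕ) :
    (#n.divisors : ℝ) ≤ A ^ #(n.primeFactors.filter (· < P)) * (n : ℝ) ^ δ := by
  induction n using Nat.recOnPosPrimePosCoprime with
  | zero => simp [Real.zero_rpow hδ.ne']
  | one => simp
  | prime_pow p k hp hk =>
    have hpow : ((p ^ k : ℕ) : ℝ) ^ δ = ((p : ℝ) ^ δ) ^ k := by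
      rw [Nat.cast_pow, ← Real.rpow_natCast, ← Real.rpow_natCast, ← Real.rpow_mul (by positivity),
        ← Real.rpow_mul (by positivity), mul_comm]
    rw [Nat.divisors_prime_pow hp, card_map, card_range, hpow,
      Nat.primeFactors_prime_pow hk.ne' hp, filter_singleton]
    push_cast
    split_ifs with h
    · rw [card_singleton, pow_one]
      refine (hA2 k).trans ?_
      have : (2 : ℝ) ≤ p := by exact_mod_cast hp.two_le
      gcongr
    · rw [card_empty, pow_zero, one_mul]
      have h2 : (2 : ℝ) ≤ (p : ℝ) ^ δ := hP.trans (by gcongr; omega)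
      have h3 : (k : ℝ) + 1 ≤ 2 ^ k := by exact_mod_cast Nat.lt_two_pow_self
      exact h3.trans (by gcongr)
  | coprime a b ha hb hab iha ihb =>
    rw [hab.card_divisors_mul, hab.primeFactors_mul, filter_union, card_union_of_disjoint
      (disjoint_filter_filter hab.disjoint_primeFactors), pow_add, Nat.cast_mul, Nat.cast_mul,
      Real.mul_rpow (by positivity) (by positivity)]
    calc _ ≤ _ := mul_le_mul iha ihb (by positivity) (by positivity)
      _ = _ := by ring

/-- The divisor bound `d(n) ≪ n ^ δ`. -/
lemma exists_card_divisors_le_mul_rpow {δ : ℝ} (hδ : 0 < δ) :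
    ∃ C : ℝ, 1 ≤ C ∧ ∀ n : ℕ, (#n.divisors : ℝ) ≤ C * (n : ℝ) ^ δ := by
  set s : ℝ := (2 : ℝ) ^ δ - 1 with hs
  have hs0 : 0 < s := sub_pos.2 (Real.one_lt_rpow (by norm_num) hδ)
  set A : ℝ := 1 + 1 / s with hAdef
  have hA : 1 ≤ A := by
    have : 0 < 1 / s := by positivity
    linarith
  obtain ⟨P, hP⟩ := exists_nat_ge ((2 : ℝ) ^ (1 / δ))
  have hP2 : 2 ≤ (P : ℝ) ^ δ := by
    calc (2 : ℝ) = ((2 : ℝ) ^ (1 / δ)) ^ δ := by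
          rw [← Real.rpow_mul (by norm_num), one_div_mul_cancel hδ.ne', Real.rpow_one]
      _ ≤ _ := by gcongr
  have hA2 : ∀ k : ℕ, (k : ℝ) + 1 ≤ A * ((2 : ℝ) ^ δ) ^ k := by
    intro k
    have h1 := one_add_mul_le_pow (a := s) (by linarith) k
    have h2 : 1 + s = (2 : ℝ) ^ δ := by rw [hs]; ring
    rw [h2] at h1
    refine le_trans ?_ (mul_le_mul_of_nonneg_left h1 (by linarith))
    have : A * (1 + k * s) = 1 + k + 1 / s + k * s := by
      rw [hAdef]; field_simp; ring
    rw [this]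
    have : 0 < 1 / s := by positivity
    have : 0 ≤ k * s := by positivity
    linarith
  refine ⟨A ^ P, one_le_pow₀ hA, fun n => ?_⟩
  refine (card_divisors_le_pow_mul_rpow hδ hA hA2 hP2 n).trans ?_
  gcongr
  calc _ ≤ #(range P) := card_le_card fun p hp => by simpa using (mem_filter.1 hp).2
      _ = P := card_range P

lemma card_cube_eq_one_le_three {p : ℕ} (hp : p.Prime) (k : ℕ) [NeZero (p ^ k)] :
    #{x : (ZMod (p ^ k))ˣ | x ^ 3 = 1} ≤ 3 := by
  rcases eq_or_ne p 2 with rfl | h2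
  · have : ({x : (ZMod (2 ^ k))ˣ | x ^ 3 = 1} : Finset _) ⊆ {1} := by
      intro x hx
      have hx3 : orderOf x ∣ 3 := orderOf_dvd_of_pow_eq_one (by simpa using hx)
      have hx2 : orderOf x ∣ 2 ^ (k + 1) := by
        refine (orderOf_dvd_card).trans ?_
        rw [ZMod.card_units_eq_totient]
        rcases k with _ | k
        · simp
        · rw [Nat.totient_prime_pow_succ Nat.prime_two]
          simpa using pow_dvd_pow 2 (by omega : k ≤ k + 1 + 1)
      have hco : Nat.Coprime 3 (2 ^ (k + 1)) := Nat.Coprime.pow_right _ (by norm_num)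
      have := Nat.eq_one_of_dvd_coprimes hco hx3 hx2
      simpa using orderOf_eq_one_iff.1 this
    exact (card_le_card this).trans (by simp)
  · have := ZMod.isCyclic_units_of_prime_pow p hp h2 k
    exact IsCyclic.card_pow_eq_one_le (by norm_num)

lemma card_cube_eq_one_mul_le {m n : ℕ} [NeZero m] [NeZero n] [NeZero (m * n)]
    (h : m.Coprime n) :
    #{x : (ZMod (m * n))ˣ | x ^ 3 = 1} ≤
      #{x : (ZMod m)ˣ | x ^ 3 = 1} * #{x : (ZMod n)ˣ | x ^ 3 = 1} := by
  let e : (ZMod (m * n))ˣ ≃* (ZMod m)ˣ × (ZMod n)ˣ :=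
    (Units.mapEquiv (ZMod.chineseRemainder h).toMulEquiv).trans MulEquiv.prodUnits
  rw [← card_product]
  refine card_le_card_of_injOn e (fun x hx => ?_) e.injective.injOn
  have hx : x ^ 3 = 1 := by simpa using hx
  have : e x ^ 3 = 1 := by rw [← map_pow, hx, map_one]
  simpa [Prod.ext_iff] using this

/-- The number of cube roots of unity modulo `q` is at most `d(q) ^ 2`. -/
lemma card_cube_eq_one_le : ∀ (q : ℕ) [NeZero q],
    #{x : (ZMod q)ˣ | x ^ 3 = 1} ≤ #q.divisors ^ 2 := by
  intro q
  induction q using Nat.recOnPosPrimePosCoprime with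
  | zero => intro h; exact absurd rfl h.out
  | one => intro _; exact (card_le_univ _).trans (by simp)
  | prime_pow p k hp hk =>
    intro _
    refine (card_cube_eq_one_le_three hp k).trans ?_
    rw [Nat.divisors_prime_pow hp, card_map, card_range]
    nlinarith
  | coprime a b ha hb hab iha ihb =>
    intro _
    have : NeZero a := ⟨by omega⟩
    have : NeZero b := ⟨by omega⟩
    refine (card_cube_eq_one_mul_le hab).trans ?_
    rw [hab.card_divisors_mul, mul_pow]
    exact Nat.mul_le_mul iha ihb

lemma N3_eq_sum_units (q : ℕ) [NeZero q] (n : ℤ) :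
    N3 q n = #{x : (ZMod q)ˣ | (x : ZMod q) ^ 3 = n} := by
  refine card_bij (fun x hx => ZMod.unitOfCoprime x (mem_filter.1 hx).2.1) ?_ ?_ ?_
  · intro x hx
    have h := (ZMod.intCast_zmod_eq_zero_iff_dvd _ _).2 (mem_filter.1 hx).2.2
    push_cast at h
    simpa using sub_eq_zero.1 h
  · intro x hx y hy hxy
    have h : (x : ZMod q) = y := by simpa using congrArg Units.val hxy
    rw [ZMod.natCast_eq_natCast_iff] at h
    simp only [mem_filter, mem_Icc] at hx hy
    rcases le_total x y with hle | hle
    · have := (Nat.modEq_iff_dvd' hle).1 h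
      have := Nat.eq_zero_of_dvd_of_lt this (by omega)
      omega
    · have := (Nat.modEq_iff_dvd' hle).1 h.symm
      have := Nat.eq_zero_of_dvd_of_lt this (by omega)
      omega
  · intro y hy
    obtain ⟨x, hx, hxy⟩ : ∃ x ∈ Icc 1 q, (x : ZMod q) = y := by
      rcases Nat.eq_zero_or_pos (y : ZMod q).val with h | h
      · refine ⟨q, mem_Icc.2 ⟨Nat.pos_of_neZero q, le_rfl⟩, ?_⟩
        rw [ZMod.natCast_self, (ZMod.val_eq_zero _).1 h]
      · exact ⟨_, mem_Icc.2 ⟨h, (ZMod.val_lt _).le⟩, ZMod.natCast_zmod_val _⟩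
    have hco : x.Coprime q := (ZMod.isUnit_iff_coprime x q).1 (hxy ▸ y.isUnit)
    have hy : (y : ZMod q) ^ 3 = n := by simpa using hy
    refine ⟨x, mem_filter.2 ⟨hx, hco, ?_⟩, Units.ext (by simpa using hxy)⟩
    rw [← ZMod.intCast_zmod_eq_zero_iff_dvd]
    push_cast
    rw [hxy, hy, sub_self]

/-- `N₃(n; q)` is the sum of the values at `n` of the characters of order dividing three. -/
lemma N3_eq_sum_dirichletCharacter (q : ℕ) [NeZero q] (n : ℤ) :
    (N3 q n : ℂ) = ∑ χ : DirichletCharacter ℂ q with χ ^ 3 = 1, χ (n : ZMod q) := by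
  have htot : (q.totient : ℂ) ≠ 0 := by
    exact_mod_cast (Nat.totient_pos.2 (Nat.pos_of_neZero q)).ne'
  have hunits : ∀ χ : DirichletCharacter ℂ q,
      ∑ x : (ZMod q)ˣ, χ ((x : ZMod q) ^ 3)⁻¹ = if χ ^ 3 = 1 then (q.totient : ℂ) else 0 := by
    intro χ
    have h1 : ∑ x : (ZMod q)ˣ, χ ((x : ZMod q) ^ 3)⁻¹ = ∑ x : (ZMod q)ˣ, (χ ^ 3) (x : ZMod q) := by
      refine Fintype.sum_equiv (Equiv.inv _) _ _ fun x => ?_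
      rw [MulChar.pow_apply_coe, ← map_pow, Equiv.inv_apply, ← Units.val_pow_eq_pow_val,
        ← Units.val_pow_eq_pow_val, ZMod.inv_coe_unit, inv_pow]
    have h2 : ∑ x : (ZMod q)ˣ, (χ ^ 3) (x : ZMod q) = ∑ x : ZMod q, (χ ^ 3) x := by
      refine sum_of_injOn Units.val Units.val_injective.injOn (fun _ _ => by simp) ?_
        fun _ _ => rfl
      intro x _ hx
      exact MulChar.map_nonunit _ fun ⟨y, hy⟩ => hx ⟨y, by simp, hy⟩
    rw [h1, h2]
    split_ifs with h
    · rw [h, MulChar.sum_one_eq_card_units, ZMod.card_units_eq_totient]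
    · exact MulChar.sum_eq_zero_of_ne_one h
  have key : (q.totient : ℂ) * N3 q n =
      q.totient * ∑ χ : DirichletCharacter ℂ q with χ ^ 3 = 1, χ (n : ZMod q) := by
    calc (q.totient : ℂ) * N3 q n
        = ∑ x : (ZMod q)ˣ, ∑ χ : DirichletCharacter ℂ q,
            χ ((x : ZMod q) ^ 3)⁻¹ * χ (n : ZMod q) := by
          rw [N3_eq_sum_units, card_filter, Nat.cast_sum, mul_sum]
          refine sum_congr rfl fun x _ => ?_
          rw [DirichletCharacter.sum_char_inv_mul_char_eq ℂ (x.isUnit.pow 3)]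
          split_ifs <;> simp
      _ = ∑ χ : DirichletCharacter ℂ q,
            if χ ^ 3 = 1 then (q.totient : ℂ) * χ (n : ZMod q) else 0 := by
          rw [sum_comm]
          refine sum_congr rfl fun χ _ => ?_
          rw [← sum_mul, hunits χ, ite_mul, zero_mul]
      _ = _ := by rw [← sum_filter, mul_sum]
  exact mul_left_cancel₀ htot key

lemma card_dirichletCharacter_cube_eq_one_le (q : ℕ) [NeZero q] :
    #{χ : DirichletCharacter ℂ q | χ ^ 3 = 1} ≤ #q.divisors ^ 2 := by
  refine le_trans (le_of_eq ?_) (card_cube_eq_one_le q)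
  have h := N3_eq_sum_dirichletCharacter q 1
  rw [N3_eq_sum_units] at h
  simp only [Int.cast_one, map_one, sum_const, nsmul_eq_mul, mul_one] at h
  rw [← Nat.cast_inj (R := ℂ), ← h]
  simp only [← Units.val_pow_eq_pow_val, Units.val_eq_one]

lemma abs_sum_N3_sub_le {q l : ℕ} (hq : 0 < q) (hl : l.Coprime q) (u : ℕ) :
    |(∑ b ∈ Icc 1 u, (N3 q ((l : ℤ) * b) : ℝ)) - (Nat.totient q : ℝ) / q * u| ≤
      2 * #q.divisors ^ 3 * (√q * (1 + Real.log q)) := by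
  have : NeZero q := ⟨hq.ne'⟩
  have hone : ∀ b ∈ Icc 1 u, (1 : DirichletCharacter ℂ q) (((l : ℤ) * b : ℤ) : ZMod q) =
      if b.Coprime q then (1 : ℂ) else 0 := by
    intro b _
    push_cast
    rw [map_mul, MulChar.one_apply ((ZMod.isUnit_iff_coprime l q).2 hl), one_mul]
    split_ifs with h
    · exact MulChar.one_apply ((ZMod.isUnit_iff_coprime b q).2 h)
    · exact MulChar.map_nonunit _ (by rwa [ZMod.isUnit_iff_coprime])
  have hsum : ∑ b ∈ Icc 1 u, (N3 q ((l : ℤ) * b) : ℂ) =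
      ∑ b ∈ Icc 1 u, (if b.Coprime q then (1 : ℂ) else 0) +
      ∑ χ ∈ ({χ : DirichletCharacter ℂ q | χ ^ 3 = 1} : Finset _).erase 1,
        χ (l : ZMod q) * ∑ b ∈ Icc 1 u, χ (b : ZMod q) := by
    simp only [N3_eq_sum_dirichletCharacter]
    rw [sum_comm, ← add_sum_erase _ _ (by simp : (1 : DirichletCharacter ℂ q) ∈ _),
      sum_congr rfl hone]
    congr 1
    refine sum_congr rfl fun χ _ => ?_
    rw [mul_sum]
    refine sum_congr rfl fun b _ => ?_
    push_cast
    rw [map_mul]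
  set D : ℝ := (#q.divisors : ℝ) with hD
  set S : ℝ := √q * (1 + Real.log q) with hS
  have hD1 : 1 ≤ D := by
    have := card_pos.2 ⟨1, Nat.one_mem_divisors.2 hq.ne'⟩
    exact Nat.one_le_cast.2 this
  have hq1 : (1 : ℝ) ≤ q := by exact_mod_cast hq
  have hlog : 0 ≤ Real.log q := Real.log_natCast_nonneg _
  have hS1 : 1 ≤ S := one_le_mul_of_one_le_of_one_le (Real.one_le_sqrt.2 hq1) (by linarith)
  rw [← Real.norm_eq_abs, ← Complex.norm_real]
  push_cast
  rw [hsum, add_sub_right_comm]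
  have h1 := norm_sum_Icc_coprime_sub_le hq u
  have h2 : ‖∑ χ ∈ ({χ : DirichletCharacter ℂ q | χ ^ 3 = 1} : Finset _).erase 1,
      χ (l : ZMod q) * ∑ b ∈ Icc 1 u, χ (b : ZMod q)‖ ≤ D ^ 2 * (D * S) := by
    refine (norm_sum_le_of_le (n := fun _ => D * S) _ fun χ hχ => ?_).trans ?_
    · rw [norm_mul]
      refine (mul_le_of_le_one_left (norm_nonneg _) (DirichletCharacter.norm_le_one _ _)).trans ?_
      exact norm_sum_Icc_le_of_ne_one (ne_of_mem_erase hχ) u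
    · rw [sum_const, nsmul_eq_mul]
      gcongr
      have := (card_le_card (erase_subset (1 : DirichletCharacter ℂ q) _)).trans
        (card_dirichletCharacter_cube_eq_one_le q)
      rw [hD]
      exact_mod_cast this
  have h3 : D ≤ D ^ 3 * S := by
    calc D = D ^ 1 * 1 := by ring
      _ ≤ D ^ 3 * S := by gcongr; norm_num
  calc _ ≤ _ := norm_add_le _ _
    _ ≤ D + D ^ 2 * (D * S) := add_le_add h1 h2
    _ ≤ _ := by nlinarith

theorem sum_N3_asymptotic : ∀ ε : ℝ, 0 < ε → ∃ C : ℝ, 0 < C ∧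
    ∀ q l u : ℕ, 0 < q → 0 < l → 0 < u → Nat.gcd l q = 1 → u ≤ q →
      |(∑ b ∈ Finset.Icc 1 u, (N3 q ((l : ℤ) * b) : ℝ)) -
          (Nat.totient q : ℝ) / q * u| ≤ C * (q : ℝ) ^ ((1 : ℝ) / 2 + ε) := by
  intro ε hε
  obtain ⟨C, hC, hdiv⟩ := exists_card_divisors_le_mul_rpow (δ := ε / 4) (by positivity)
  refine ⟨2 * C ^ 3 * (1 + 1 / (ε / 4)), by positivity, fun q l u hq _ _ hl _ => ?_⟩
  refine (abs_sum_N3_sub_le hq hl u).trans ?_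
  have hq0 : (0 : ℝ) < q := by exact_mod_cast hq
  have hq1 : (1 : ℝ) ≤ q := by exact_mod_cast hq
  set Q : ℝ := (q : ℝ) ^ (ε / 4) with hQ
  have hQ1 : 1 ≤ Q := Real.one_le_rpow hq1 (by positivity)
  have hlog0 : 0 ≤ Real.log q := Real.log_natCast_nonneg _
  have hlog : 1 + Real.log q ≤ (1 + 1 / (ε / 4)) * Q := by
    have := Real.log_le_rpow_div hq0.le (by positivity : 0 < ε / 4)
    rw [add_mul, one_mul, one_div_mul_eq_div]
    linarith
  have hpow : (q : ℝ) ^ ((1 : ℝ) / 2 + ε) = √q * Q ^ 4 := by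
    rw [Real.rpow_add hq0, ← Real.sqrt_eq_rpow, hQ, ← Real.rpow_natCast, ← Real.rpow_mul hq0.le]
    congr 2
    push_cast
    ring
  calc 2 * (#q.divisors : ℝ) ^ 3 * (√q * (1 + Real.log q))
      ≤ 2 * (C * Q) ^ 3 * (√q * ((1 + 1 / (ε / 4)) * Q)) := by
        gcongr
        exact hdiv q
    _ = _ := by rw [hpow]; ring
end
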